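/- For every d ≥ 1, the set {(α₁,…,α_d) ∈ ℝ^d : liminf_{n→∞} n‖nαᵢ‖ > 0 for every 1 ≤ i ≤ d} has Hausdorff dimension equal to d, where n ranges over positive integers. -/

import Mathlib

noncomputable section

open MeasureTheory Set Filter

/-- The distance from a real number to the nearest integer. -/
def distInt (x : ℝ) : ℝ := |x - round x|

/-- The real vector in `ℝ^k` corresponding to an integer vector. -/
def intVec {k : ℕ} (n : Fin k → ℤ) : Fin k → ℝ := fun i => (n i : ℝ)

/-- The embedding of `ℝ^d` into `ℝ^k` as the span of the first `d` coordinates. -/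
def emb (k d : ℕ) (x : Fin d → ℝ) : Fin k → ℝ :=
  fun i => if h : (i : ℕ) < d then x ⟨i, h⟩ else 0

/-- A `k` to `d` cut and project scheme: a totally irrational `d`-dimensional subspace
`E ⊆ ℝ^k`, the projection `proj = π` onto `E` along a complementary subspace `F_π`
(injective on `ℤ^k`), the projection `rho = ρ` onto `E` with respect to the decomposition
`ℝ^k = E + F_ρ` where `F_ρ = {0} × ℝ^{k-d}`, a window `W ⊆ F_ρ`, and a point `s`
(a representative of a point of `ℝ^k/ℤ^k`). -/
structure CPS (k d : ℕ) where
  E : Submodule ℝ (Fin k → ℝ)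
  rank_E : Module.finrank ℝ E = d
  /-- `E` is totally irrational: its image in `ℝ^k/ℤ^k` is dense,
  equivalently `E + ℤ^k` is dense in `ℝ^k`. -/
  totallyIrrational : Dense {x : Fin k → ℝ | ∃ e ∈ E, ∃ n : Fin k → ℤ, x = e + intVec n}
  /-- `π`, the projection onto `E` along a complementary subspace `F_π = ker proj`. -/
  proj : (Fin k → ℝ) →ₗ[ℝ] (Fin k → ℝ)
  proj_mem : ∀ x, proj x ∈ E
  proj_id : ∀ x ∈ E, proj x = x
  /-- `π` is injective on `ℤ^k`. -/
  proj_inj : ∀ m n : Fin k → ℤ, proj (intVec m) = proj (intVec n) → m = n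
  /-- `ρ`, the projection onto `E` with respect to the decomposition `ℝ^k = E + F_ρ`. -/
  rho : (Fin k → ℝ) →ₗ[ℝ] (Fin k → ℝ)
  rho_mem : ∀ x, rho x ∈ E
  /-- `x - ρ(x) ∈ F_ρ = {0} × ℝ^{k-d}`; in particular `ρ* = id - ρ` maps into `F_ρ`. -/
  rho_decomp : ∀ (x : Fin k → ℝ) (i : Fin k), (i : ℕ) < d → x i - rho x i = 0
  /-- The window `W ⊆ F_ρ`. -/
  window : Set (Fin k → ℝ)
  window_sub : ∀ x ∈ window, ∀ i : Fin k, (i : ℕ) < d → x i = 0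
  /-- A representative of the point `s ∈ ℝ^k/ℤ^k`. -/
  s : Fin k → ℝ

namespace CPS

variable {k d : ℕ} (𝒟 : CPS k d)

/-- `ρ* : ℝ^k → F_ρ`, the projection onto `F_ρ` along `E`. -/
def rhoStar (x : Fin k → ℝ) : Fin k → ℝ := x - 𝒟.rho x

/-- The strip `S = W + E`. -/
def strip : Set (Fin k → ℝ) := {z | ∃ w ∈ 𝒟.window, ∃ e ∈ (𝒟.E : Set (Fin k → ℝ)), z = w + e}

/-- The cut and project set `Y = π(S ∩ (ℤ^k + s))`. -/
def Y : Set (Fin k → ℝ) :=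
  𝒟.proj '' (𝒟.strip ∩ {z | ∃ n : Fin k → ℤ, z = intVec n + 𝒟.s})

/-- `s` is regular: `ℤ^k + s` does not meet the boundary of the strip. -/
def Regular : Prop := ∀ n : Fin k → ℤ, intVec n + 𝒟.s ∉ frontier 𝒟.strip

/-- `Y` is aperiodic: its group of periods is trivial. -/
def Aperiodic : Prop := ∀ x ∈ (𝒟.E : Set (Fin k → ℝ)),
  {z | ∃ y ∈ 𝒟.Y, z = y + x} = 𝒟.Y → x = 0

/-- The window is the cubical window `{Σ_{i=d+1}^k t_i e_i : 0 ≤ t_i < 1}`. -/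
def IsCubical : Prop :=
  𝒟.window = {x : Fin k → ℝ | ∀ i : Fin k,
    if (i : ℕ) < d then x i = 0 else 0 ≤ x i ∧ x i < 1}

/-- The window is the canonical window `ρ*([0,1]^k)`. -/
def IsCanonical : Prop :=
  𝒟.window = 𝒟.rhoStar '' {x : Fin k → ℝ | ∀ i, x i ∈ Icc (0 : ℝ) 1}

/-- `Y` is a cubical cut and project set: totally irrational (a field of `CPS`),
regular, aperiodic, and formed with the cubical window. -/
def IsCubicalCPSet : Prop := 𝒟.IsCubical ∧ 𝒟.Regular ∧ 𝒟.Aperiodic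

/-- `Y` is a canonical cut and project set. -/
def IsCanonicalCPSet : Prop := 𝒟.IsCanonical ∧ 𝒟.Regular ∧ 𝒟.Aperiodic

/-- For `y ∈ Y`, the (unique, by injectivity of `π` on `ℤ^k`) integer vector `ỹ`
with `ỹ + s ∈ S` and `π(ỹ + s) = y`. -/
def intRep (y : Fin k → ℝ) : Fin k → ℤ :=
  Classical.epsilon fun n : Fin k → ℤ =>
    intVec n + 𝒟.s ∈ 𝒟.strip ∧ 𝒟.proj (intVec n + 𝒟.s) = y

/-- The patch of shape `Ω` at `y`: `P(y,Ω) = {y' ∈ Y : ρ(ỹ' - ỹ) ∈ ρ(Ω)}`,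
where `Ω ⊆ ℝ^d` is viewed inside `⟨e₁,…,e_d⟩_ℝ ⊆ ℝ^k`. -/
def patch (Ω : Set (Fin d → ℝ)) (y : Fin k → ℝ) : Set (Fin k → ℝ) :=
  {y' | y' ∈ 𝒟.Y ∧
    𝒟.rho (intVec (𝒟.intRep y') - intVec (𝒟.intRep y)) ∈ 𝒟.rho '' (emb k d '' Ω)}

/-- Two patches of shape `Ω` are equivalent if they agree up to the translation
taking one distinguished point to the other. -/
def PatchEquiv (Ω : Set (Fin d → ℝ)) (y₁ y₂ : Fin k → ℝ) : Prop :=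
  𝒟.patch Ω y₁ = {z | ∃ w ∈ 𝒟.patch Ω y₂, z = w + (y₁ - y₂)}

/-- The pattern (equivalence class) of the patch of shape `Ω` at `y` occurs in the
region `R ⊆ E`: some point `y' ∈ Y ∩ R` has patch equivalent to that at `y`. -/
def OccursIn (Ω : Set (Fin d → ℝ)) (y : Fin k → ℝ) (R : Set (Fin k → ℝ)) : Prop :=
  ∃ y' ∈ 𝒟.Y ∩ R, 𝒟.PatchEquiv Ω y' y

/-- `Y` is linearly repetitive with respect to a collection `𝒜` of shapes in `ℝ^d`:
there is `C > 0` such that for every `Ω ∈ 𝒜`, every pattern of shape `Ω` occurring in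
`Y` occurs in every ball in `E` of volume `C·|Ω|` (balls in `E` being images under the
identification `ρ ∘ emb : ℝ^d ≅ E` of balls in `ℝ^d`). -/
def IsLR (𝒜 : Set (Set (Fin d → ℝ))) : Prop :=
  ∃ C > (0 : ℝ), ∀ Ω ∈ 𝒜, ∀ y ∈ 𝒟.Y, ∀ (x : Fin d → ℝ) (r : ℝ),
    volume (Metric.closedBall x r) = ENNReal.ofReal C * volume Ω →
    𝒟.OccursIn Ω y (𝒟.rho '' (emb k d '' Metric.closedBall x r))

/-- `Y` is `LR_Ω` with respect to a collection `𝒜` of shapes in `ℝ^d`: there is `C > 0`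
such that for every `Ω ∈ 𝒜`, every pattern of shape `Ω` occurring in `Y` occurs in every
translate of `C·Ω`. -/
def IsLROmega (𝒜 : Set (Set (Fin d → ℝ))) : Prop :=
  ∃ C > (0 : ℝ), ∀ Ω ∈ 𝒜, ∀ y ∈ 𝒟.Y, ∀ x : Fin d → ℝ,
    𝒟.OccursIn Ω y (𝒟.rho '' (emb k d '' {z | ∃ w ∈ Ω, z = x + C • w}))

end CPS

/-- `ℛ_d`: aligned rectangles in `ℝ^d` with integer vertices and nonempty interior. -/
def RdCollection (d : ℕ) : Set (Set (Fin d → ℝ)) :=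
  {Ω | ∃ a b : Fin d → ℤ, (∀ i, a i < b i) ∧
    Ω = {x : Fin d → ℝ | ∀ i, (a i : ℝ) ≤ x i ∧ x i ≤ (b i : ℝ)}}

/-- `𝒞_d`: convex polytopes in `ℝ^d` with vertices in `ℤ^d` and nonempty interior. -/
def CdCollection (d : ℕ) : Set (Set (Fin d → ℝ)) :=
  {Ω | (∃ V : Finset (Fin d → ℤ),
      Ω = convexHull ℝ ((fun n : Fin d → ℤ => intVec n) '' (V : Set (Fin d → ℤ)))) ∧
    (interior Ω).Nonempty}


/-- The key one-step lemma: at most one of the `M + 1` subintervals meets a dangerous set. -/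
theorem exists_bad_index (M n : ℕ) (L : ℝ) :
    ∃ b : Fin (M + 1), ∀ j : Fin (M + 1), j ≠ b → ∀ x : ℝ,
      L + 2 * (j : ℝ) * ((2 * M + 2 : ℝ) ^ (n + 1))⁻¹ ≤ x →
      x ≤ L + (2 * (j : ℝ) + 1) * ((2 * M + 2 : ℝ) ^ (n + 1))⁻¹ →
      ∀ (q : ℕ) (p : ℤ), 0 < q → (2 * M + 2 : ℝ) ^ n ≤ 4 * (q : ℝ) ^ 2 * (2 * M + 2) →
      4 * (q : ℝ) ^ 2 < (2 * M + 2 : ℝ) ^ n →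
      1 / (8 * (2 * M + 2 : ℝ) ^ 2) / (q : ℝ) ^ 2 ≤ |x - p / q| := by
  by_contra! hcon
  obtain ⟨j, -, x, hx1, hx2, q, p, hq, hq1, hq2, hx⟩ := hcon 0
  obtain ⟨j', hj, x', hx1', hx2', q', p', hq', hq1', hq2', hx'⟩ := hcon j
  have hR : (2 : ℝ) ≤ 2 * M + 2 := by
    have : (0 : ℝ) ≤ M := Nat.cast_nonneg M
    linarith
  have hjM : (j : ℝ) ≤ M := by exact_mod_cast Nat.lt_succ_iff.mp j.2
  have hjM' : (j' : ℝ) ≤ M := by exact_mod_cast Nat.lt_succ_iff.mp j'.2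
  have hj0 : (0 : ℝ) ≤ (j : ℕ) := Nat.cast_nonneg _
  have hj0' : (0 : ℝ) ≤ (j' : ℕ) := Nat.cast_nonneg _
  have hMR : (2 * M + 2 : ℝ) * ((2 * M + 2 : ℝ) ^ (n + 1))⁻¹ = ((2 * M + 2 : ℝ) ^ n)⁻¹ := by
    rw [pow_succ, mul_inv, mul_comm, mul_assoc, inv_mul_cancel₀ (by positivity), mul_one]
  have hMdef : (M : ℝ) = ((2 * M + 2 : ℝ) - 2) / 2 := by ring
  generalize hRd : (2 * M + 2 : ℝ) = R at *
  have hRn : 0 < R ^ n := by positivity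
  set ε := (R ^ (n + 1))⁻¹ with hε
  have hε0 : 0 < ε := by positivity
  have hsmall : ∀ q : ℕ, 0 < q → R ^ n ≤ 4 * (q : ℝ) ^ 2 * R →
      1 / (8 * R ^ 2) / (q : ℝ) ^ 2 ≤ ε / 2 := by
    intro q hq h
    have hq0 : (0 : ℝ) < q := by exact_mod_cast hq
    rw [hε, div_div, inv_eq_one_div, div_div, div_le_div_iff₀ (by positivity) (by positivity)]
    have : R ^ (n + 1) = R ^ n * R := pow_succ R n
    nlinarith
  have h1 := hsmall q hq hq1
  have h2 := hsmall q' hq' hq1'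
  have hq0 : (0 : ℝ) < q := by exact_mod_cast hq
  have hq0' : (0 : ℝ) < q' := by exact_mod_cast hq'
  have a1 := abs_lt.mp (lt_of_lt_of_le hx h1)
  have a2 := abs_lt.mp (lt_of_lt_of_le hx' h2)
  by_cases hpq : (p : ℝ) / q = p' / q'
  · rw [hpq] at a1
    rcases lt_or_gt_of_ne hj with h | h
    · have : (j' : ℝ) + 1 ≤ (j : ℕ) := by exact_mod_cast h
      nlinarith
    · have : (j : ℝ) + 1 ≤ (j' : ℕ) := by exact_mod_cast h
      nlinarith
  · have hdiff : 1 / ((q : ℝ) * q') ≤ |(p : ℝ) / q - p' / q'| := by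
      have hne : p * q' - p' * q ≠ 0 := by
        intro h
        apply hpq
        rw [div_eq_div_iff hq0.ne' hq0'.ne']
        have : p * q' = p' * q := by linarith
        exact_mod_cast this
      have hge : (1 : ℝ) ≤ |(p : ℝ) * q' - p' * q| := by
        exact_mod_cast Int.one_le_abs hne
      rw [div_sub_div _ _ hq0.ne' hq0'.ne', abs_div, abs_of_pos (mul_pos hq0 hq0')]
      have e : (p : ℝ) * q' - q * p' = p * q' - p' * q := by ring
      rw [e]
      gcongr
    have hlow : 4 * (R ^ n)⁻¹ < 1 / ((q : ℝ) * q') := by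
      rw [← div_eq_mul_inv, div_lt_div_iff₀ hRn (by positivity)]
      nlinarith [sq_nonneg ((q : ℝ) - q')]
    have hup : |(p : ℝ) / q - p' / q'| ≤ 2 * (R ^ n)⁻¹ := by
      have b1 : 2 * (j : ℝ) * ε ≤ (R - 2) * ε :=
        mul_le_mul_of_nonneg_right (by linarith) hε0.le
      have b2 : 2 * (j' : ℝ) * ε ≤ (R - 2) * ε :=
        mul_le_mul_of_nonneg_right (by linarith) hε0.le
      have b3 : 0 ≤ 2 * (j : ℝ) * ε := by positivity
      have b4 : 0 ≤ 2 * (j' : ℝ) * ε := by positivity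
      have b5 : 0 ≤ R * ε := by positivity
      rw [← hMR, abs_le]
      constructor <;> linarith
    have : 0 < (R ^ n)⁻¹ := by positivity
    linarith

/-- The index to be avoided at a given stage. -/
def badIdx (M n : ℕ) (L : ℝ) : Fin (M + 1) := Classical.choose (exists_bad_index M n L)

/-- Left endpoints of the intervals of the Cantor construction. -/
def leftEnd (M : ℕ) (a : ℕ → Fin M) : ℕ → ℝ
  | 0 => 0
  | n + 1 => leftEnd M a n +
      2 * (((badIdx M n (leftEnd M a n)).succAbove (a n) : Fin (M + 1)) : ℕ) *
        ((2 * M + 2 : ℝ) ^ (n + 1))⁻¹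

/-- The point of the Cantor set with a given address. -/
def cantorPt (M : ℕ) (a : ℕ → Fin M) : ℝ := ⨆ n, leftEnd M a n

theorem cantorPt_mem (M : ℕ) (a : ℕ → Fin M) (n : ℕ) :
    leftEnd M a n ≤ cantorPt M a ∧
      cantorPt M a ≤ leftEnd M a n + ((2 * M + 2 : ℝ) ^ n)⁻¹ := by
  have hmono : Monotone (leftEnd M a) := by
    apply monotone_nat_of_le_succ
    intro n
    rw [leftEnd]
    have : (0 : ℝ) ≤ 2 * (((badIdx M n (leftEnd M a n)).succAbove (a n) : Fin (M + 1)) : ℕ) *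
        ((2 * M + 2 : ℝ) ^ (n + 1))⁻¹ := by positivity
    linarith
  have hanti : Antitone fun n => leftEnd M a n + ((2 * M + 2 : ℝ) ^ n)⁻¹ := by
    apply antitone_nat_of_succ_le
    intro n
    rw [leftEnd]
    have hMR : (2 * M + 2 : ℝ) * ((2 * M + 2 : ℝ) ^ (n + 1))⁻¹ = ((2 * M + 2 : ℝ) ^ n)⁻¹ := by
      rw [pow_succ, mul_inv, mul_comm, mul_assoc, inv_mul_cancel₀ (by positivity), mul_one]
    have hj : ((((badIdx M n (leftEnd M a n)).succAbove (a n) : Fin (M + 1)) : ℕ) : ℝ) ≤ M := by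
      exact_mod_cast Nat.lt_succ_iff.mp (Fin.is_lt _)
    have : (0 : ℝ) < ((2 * M + 2 : ℝ) ^ (n + 1))⁻¹ := by positivity
    rw [← hMR]
    nlinarith
  have := hmono.ciSup_mem_iInter_Icc_of_antitone hanti (fun n => by
    have : (0 : ℝ) < ((2 * M + 2 : ℝ) ^ n)⁻¹ := by positivity
    simp only
    linarith)
  exact Set.mem_iInter.mp this n

theorem cantorPt_bad (M : ℕ) (a : ℕ → Fin M) (q : ℕ) (p : ℤ) (hq : 0 < q) :
    1 / (8 * (2 * M + 2 : ℝ) ^ 2) / (q : ℝ) ^ 2 ≤ |cantorPt M a - p / q| := by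
  have hq0 : (1 : ℝ) ≤ q := by exact_mod_cast hq
  have hM : 0 < M := Fin.pos (a 0)
  have hM1 : (1 : ℝ) ≤ M := by exact_mod_cast hM
  have hex : ∃ n : ℕ, 4 * (q : ℝ) ^ 2 < (2 * M + 2 : ℝ) ^ n :=
    pow_unbounded_of_one_lt _ (by linarith)
  classical
  have hn := Nat.find_spec hex
  have hmin := fun m => Nat.find_min (m := m) hex
  generalize Nat.find hex = n at hn hmin
  have hlow : (2 * M + 2 : ℝ) ^ n ≤ 4 * (q : ℝ) ^ 2 * (2 * M + 2) := by
    cases n with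
    | zero => norm_num at hn; nlinarith
    | succ m =>
      have := not_lt.mp (hmin m (Nat.lt_succ_self m))
      rw [pow_succ]
      gcongr
  have hmem := cantorPt_mem M a (n + 1)
  rw [leftEnd] at hmem
  refine Classical.choose_spec (exists_bad_index M n (leftEnd M a n)) _
    (Fin.succAbove_ne _ (a n)) _ hmem.1 ?_ q p hq hlow hn
  have := hmem.2
  unfold badIdx at this
  linarith

theorem cantorPt_sep (M : ℕ) (a b : ℕ → Fin M) (n : ℕ) (h : ∀ i < n, a i = b i)
    (hn : a n ≠ b n) :
    ((2 * M + 2 : ℝ) ^ (n + 1))⁻¹ ≤ |cantorPt M a - cantorPt M b| := by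
  have hL : ∀ m ≤ n, leftEnd M a m = leftEnd M b m := by
    intro m
    induction m with
    | zero => intro _; rfl
    | succ m ih =>
      intro hm
      rw [leftEnd, leftEnd, ih (by omega), h m (by omega)]
  have ha := cantorPt_mem M a (n + 1)
  have hb := cantorPt_mem M b (n + 1)
  rw [leftEnd] at ha hb
  rw [hL n le_rfl] at ha
  have hne := fun h' => hn (Fin.succAbove_right_injective (p := badIdx M n (leftEnd M b n)) h')
  generalize (badIdx M n (leftEnd M b n)).succAbove (a n) = j at *
  generalize (badIdx M n (leftEnd M b n)).succAbove (b n) = j' at *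
  have hε : (0 : ℝ) < ((2 * M + 2 : ℝ) ^ (n + 1))⁻¹ := by positivity
  rcases lt_or_gt_of_ne hne with h | h
  · have : (j : ℝ) + 1 ≤ (j' : ℕ) := by exact_mod_cast h
    rw [abs_sub_comm, le_abs]
    left
    nlinarith
  · have : (j' : ℝ) + 1 ≤ (j : ℕ) := by exact_mod_cast h
    rw [le_abs]
    left
    nlinarith

theorem cantorPt_holder (M : ℕ) (hM : 2 ≤ M) (r : ℝ) (hr : r = Real.log M / Real.log (2 * M + 2))
    (a b : ℕ → Fin M) :
    |Real.ofDigits a - Real.ofDigits b| ≤ M * |cantorPt M a - cantorPt M b| ^ r := by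
  by_cases hab : a = b
  · subst hab
    simp only [sub_self, abs_zero]
    positivity
  have hex : ∃ n, a n ≠ b n := Function.ne_iff.mp hab
  classical
  have hn := Nat.find_spec hex
  have hmin := fun m => Nat.find_min (m := m) hex
  generalize Nat.find hex = n at hn hmin
  have hmin' : ∀ i < n, a i = b i := fun i hi => not_not.mp (hmin i hi)
  have hM2 : (2 : ℝ) ≤ M := by exact_mod_cast hM
  have hr0 : 0 ≤ r := by
    rw [hr]
    exact div_nonneg (Real.log_nonneg (by linarith)) (Real.log_nonneg (by linarith))
  have hRr : (2 * M + 2 : ℝ) ^ r = M := by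
    rw [hr, Real.rpow_def_of_pos (by positivity), mul_div_cancel₀, Real.exp_log (by positivity)]
    exact (Real.log_pos (by linarith)).ne'
  calc |Real.ofDigits a - Real.ofDigits b| ≤ ((M : ℝ) ^ n)⁻¹ :=
        Real.abs_ofDigits_sub_ofDigits_le hmin'
    _ = M * (((2 * M + 2 : ℝ) ^ (n + 1))⁻¹) ^ r := by
        rw [Real.inv_rpow (by positivity), ← Real.rpow_natCast (2 * M + 2 : ℝ),
          ← Real.rpow_mul (by positivity),
          mul_comm _ r, Real.rpow_mul (by positivity), hRr, Real.rpow_natCast, pow_succ]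
        field_simp
    _ ≤ _ := by
        gcongr
        exact cantorPt_sep M a b n hmin' hn

theorem cantorPt_injective (M : ℕ) : Function.Injective (cantorPt M) := by
  intro a b hab
  by_contra hne
  have hex : ∃ n, a n ≠ b n := Function.ne_iff.mp hne
  classical
  have h := cantorPt_sep M a b (Nat.find hex)
    (fun i hi => not_not.mp (Nat.find_min hex hi)) (Nat.find_spec hex)
  rw [hab, sub_self, abs_zero] at h
  have : (0 : ℝ) < ((2 * M + 2 : ℝ) ^ (Nat.find hex + 1))⁻¹ := by positivity
  linarith

theorem liminf_pos_of_bad (x c : ℝ) (hc : 0 < c)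
    (h : ∀ (q : ℕ) (p : ℤ), 0 < q → c / (q : ℝ) ^ 2 ≤ |x - p / q|) :
    0 < Filter.liminf (fun n : ℕ => (n : ℝ) * distInt ((n : ℝ) * x)) Filter.atTop := by
  have key : ∀ q : ℕ, 0 < q → c ≤ (q : ℝ) * distInt ((q : ℝ) * x) := by
    intro q hq
    have hq0 : (0 : ℝ) < q := by exact_mod_cast hq
    have h1 := h q (round ((q : ℝ) * x)) hq
    rw [div_le_iff₀ (by positivity)] at h1
    refine h1.trans (le_of_eq ?_)
    unfold distInt
    have e : (q : ℝ) * x - round ((q : ℝ) * x) = q * (x - round ((q : ℝ) * x) / q) := by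
      field_simp
    rw [e, abs_mul, abs_of_pos hq0]
    ring
  refine lt_of_lt_of_le hc (Filter.le_liminf_of_le ?_ ?_)
  · apply Filter.IsCoboundedUnder.of_frequently_le (a := 1)
    rw [Filter.frequently_atTop]
    intro K
    obtain ⟨N, hN⟩ := exists_nat_gt ((K : ℝ) / c)
    obtain ⟨k, hk0, hkN, hk⟩ := Real.exists_nat_abs_mul_sub_round_le x (n := N + 1) (by omega)
    have hk' : distInt ((k : ℝ) * x) ≤ 1 / (N + 2) := by
      refine hk.trans (le_of_eq ?_)
      push_cast
      ring
    have hk1 : (0 : ℝ) < k := by exact_mod_cast hk0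
    have h1 := (key k hk0).trans (mul_le_mul_of_nonneg_left hk' hk1.le)
    rw [mul_one_div, le_div_iff₀ (by positivity)] at h1
    rw [div_lt_iff₀ hc] at hN
    refine ⟨k, ?_, ?_⟩
    · have : (K : ℝ) ≤ k := by nlinarith
      exact_mod_cast this
    · refine (mul_le_mul_of_nonneg_left hk' hk1.le).trans ?_
      rw [mul_one_div, div_le_one (by positivity)]
      have : (k : ℝ) ≤ N + 1 := by exact_mod_cast hkN
      linarith
  · filter_upwards [Filter.eventually_gt_atTop 0] with q hq using key q hq

theorem dimH_lower (d M : ℕ) (hM : 2 ≤ M) :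
    ENNReal.ofReal (Real.log M / Real.log (2 * M + 2)) * d ≤
      dimH {α : EuclideanSpace ℝ (Fin d) | ∀ i : Fin d, α i ∈ Set.range (cantorPt M)} := by
  have hM2 : (2 : ℝ) ≤ M := by exact_mod_cast hM
  have : Nonempty (Fin M) := ⟨⟨0, by omega⟩⟩
  set S := {α : EuclideanSpace ℝ (Fin d) | ∀ i : Fin d, α i ∈ Set.range (cantorPt M)} with hS
  set r := Real.log M / Real.log (2 * M + 2) with hr
  have hr0 : 0 < r := div_pos (Real.log_pos (by linarith)) (Real.log_pos (by linarith))
  let F : EuclideanSpace ℝ (Fin d) → (Fin d → ℝ) := fun α i =>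
    Real.ofDigits (Function.invFun (cantorPt M) (α i))
  have hinv : ∀ a, Function.invFun (cantorPt M) (cantorPt M a) = a :=
    Function.leftInverse_invFun (cantorPt_injective M)
  have hF : HolderOnWith (M : NNReal) r.toNNReal F S := by
    intro x hx y hy
    rw [edist_pi_le_iff]
    intro i
    obtain ⟨a, ha⟩ := hx i
    obtain ⟨b, hb⟩ := hy i
    have h1 : dist (F x i) (F y i) ≤ M * dist x y ^ r := by
      simp only [F]
      rw [← ha, ← hb, hinv, hinv, Real.dist_eq]
      refine (cantorPt_holder M hM r hr a b).trans ?_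
      gcongr
      rw [ha, hb, ← Real.dist_eq, EuclideanSpace.dist_eq]
      apply Real.le_sqrt_of_sq_le
      exact Finset.single_le_sum (f := fun i => dist (x i) (y i) ^ 2)
        (fun _ _ => by positivity) (Finset.mem_univ i)
    rw [edist_dist, edist_dist, Real.coe_toNNReal r hr0.le,
      ENNReal.ofReal_rpow_of_nonneg dist_nonneg hr0.le]
    refine (ENNReal.ofReal_le_ofReal h1).trans (le_of_eq ?_)
    rw [ENNReal.ofReal_mul (by positivity)]
    simp
  have hdim := hF.dimH_image_le (by simpa using hr0)
  have himg : Set.pi Set.univ (fun _ : Fin d => Set.Icc (0 : ℝ) 1) ⊆ F '' S := by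
    intro y hy
    have hch : ∀ i, ∃ a : ℕ → Fin M, Real.ofDigits a = y i := fun i => by
      obtain ⟨a, -, ha⟩ := Real.ofDigits_SurjOn (b := M) (by omega) (hy i (Set.mem_univ i))
      exact ⟨a, ha⟩
    choose a ha using hch
    refine ⟨WithLp.toLp 2 (fun i => cantorPt M (a i)), fun i => ⟨a i, rfl⟩, ?_⟩
    ext i
    simp only [F]
    rw [hinv, ha]
  have hcube : dimH (Set.pi Set.univ (fun _ : Fin d => Set.Icc (0 : ℝ) 1)) = d := by
    have := Real.dimH_of_nonempty_interior (E := Fin d → ℝ)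
      (s := Set.pi Set.univ (fun _ : Fin d => Set.Icc (0 : ℝ) 1)) (by
        rw [interior_pi_set Set.finite_univ]
        refine ⟨fun _ => 1 / 2, fun i _ => ?_⟩
        simp only [interior_Icc]
        constructor <;> norm_num)
    simpa using this
  have hle := (dimH_mono himg).trans hdim
  rw [hcube] at hle
  rw [mul_comm]
  exact ENNReal.mul_le_of_le_div hle

theorem tendsto_exponent :
    Filter.Tendsto (fun M : ℕ => Real.log M / Real.log (2 * M + 2)) Filter.atTop (nhds 1) := by
  have hlog : Filter.Tendsto (fun M : ℕ => Real.log M) Filter.atTop Filter.atTop :=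
    Real.tendsto_log_atTop.comp tendsto_natCast_atTop_atTop
  have hlow : Filter.Tendsto (fun M : ℕ => 1 - Real.log 4 / (Real.log 4 + Real.log M))
      Filter.atTop (nhds 1) := by
    have := (Filter.tendsto_atTop_add_const_left _ (Real.log 4) hlog).const_div_atTop (Real.log 4)
    simpa using this.const_sub 1
  have h4 : 0 < Real.log 4 := Real.log_pos (by norm_num)
  refine tendsto_of_tendsto_of_tendsto_of_le_of_le' hlow tendsto_const_nhds ?_ ?_
  · filter_upwards [Filter.eventually_ge_atTop 2] with M hM
    have hM2 : (2 : ℝ) ≤ M := by exact_mod_cast hM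
    have hl : 0 < Real.log M := Real.log_pos (by linarith)
    have e : 1 - Real.log 4 / (Real.log 4 + Real.log M) =
        Real.log M / (Real.log 4 + Real.log M) := by
      field_simp
      ring
    rw [e]
    have : Real.log (2 * M + 2) ≤ Real.log 4 + Real.log M := by
      rw [← Real.log_mul (by norm_num) (by positivity)]
      exact Real.log_le_log (by positivity) (by linarith)
    have h0 : 0 < Real.log (2 * M + 2) := Real.log_pos (by linarith)
    gcongr
  · filter_upwards [Filter.eventually_ge_atTop 2] with M hM
    have hM2 : (2 : ℝ) ≤ M := by exact_mod_cast hM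
    rw [div_le_one (Real.log_pos (by linarith))]
    exact Real.log_le_log (by positivity) (by linarith)

/-- For every `d ≥ 1`, the set of `(α₁,…,α_d) ∈ ℝ^d` such that
`liminf_{n→∞} n‖nαᵢ‖ > 0` for every `i` has Hausdorff dimension `d`. -/
theorem dimH_badly_approximable_coordinates (d : ℕ) (hd : 1 ≤ d) :
    dimH {α : EuclideanSpace ℝ (Fin d) | ∀ i : Fin d,
      0 < Filter.liminf
        (fun n : ℕ => (n : ℝ) * distInt ((n : ℝ) * α i)) Filter.atTop} = d := by
  apply le_antisymm
  · refine (dimH_mono (Set.subset_univ _)).trans (le_of_eq ?_)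
    rw [Real.dimH_univ_eq_finrank]
    simp
  · have hT : Filter.Tendsto
        (fun M : ℕ => ENNReal.ofReal (Real.log M / Real.log (2 * M + 2)) * (d : ENNReal))
        Filter.atTop (nhds (ENNReal.ofReal 1 * (d : ENNReal))) :=
      ENNReal.Tendsto.mul_const (ENNReal.tendsto_ofReal tendsto_exponent)
        (Or.inr (ENNReal.natCast_ne_top d))
    rw [ENNReal.ofReal_one, one_mul] at hT
    refine le_of_tendsto hT ?_
    filter_upwards [Filter.eventually_ge_atTop 2] with M hM
    refine (dimH_lower d M hM).trans (dimH_mono ?_)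
    intro α hα i
    obtain ⟨a, ha⟩ := hα i
    rw [← ha]
    exact liminf_pos_of_bad _ _ (by positivity) (cantorPt_bad M a)
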